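/- arXiv:1911.01749 — 2 statements merged into one kernel-verified Lean document; each statement's English description precedes it below -/
import Mathlib

section
/- Let m ≥ 1 be a squarefree positive integer. Then every integer occurs as a coefficient of Φ*_{mn} for some n ≥ 1, and every integer occurs as a coefficient of Ψ*_{mn} for some n ≥ 1. -/
open Polynomial

/-- The unitary cyclotomic polynomial `Φ*_n = ∏_{d ∣ n, rad(d) = rad(n)} Φ_d`. -/
noncomputable def unitaryCyclotomic (n : ℕ) : Polynomial ℤ :=
  ∏ d ∈ n.divisors.filter (fun d => d.primeFactors = n.primeFactors), cyclotomic d ℤ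

/-- The inverse unitary cyclotomic polynomial `Ψ*_n`, satisfying `Φ*_n · Ψ*_n = X^n − 1`. -/
noncomputable def unitaryCyclotomicInv (n : ℕ) : Polynomial ℤ :=
  (X ^ n - 1) /ₘ unitaryCyclotomic n

open Finset in
lemma exists_dyadic_block_card_primes_ge (T : ℕ) :
    ∃ k, T ≤ #{p ∈ Ico (2 ^ k) (2 ^ (k + 1)) | p.Prime} := by
  by_contra! h
  apply not_summable_one_div_on_primes
  set g : ℕ → ℝ := Set.indicator {p : ℕ | p.Prime} (fun n : ℕ => (1 : ℝ) / n) with hg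
  have g_nonneg : ∀ n, 0 ≤ g n := fun n => Set.indicator_nonneg (fun _ _ => by positivity) n
  have block : ∀ k, ∑ n ∈ Ico (2 ^ k) (2 ^ (k + 1)), g n ≤ T * (1 / 2 : ℝ) ^ k := by
    intro k
    have : ∑ n ∈ Ico (2 ^ k) (2 ^ (k + 1)), g n
        = ∑ n ∈ Ico (2 ^ k) (2 ^ (k + 1)) with Nat.Prime n, 1 / (n : ℝ) := by
      rw [sum_filter]
      exact sum_congr rfl fun n _ => by simp [hg, Set.indicator_apply]
    rw [this]
    refine (sum_le_card_nsmul _ _ ((1 / 2 : ℝ) ^ k) fun n hn => ?_).trans ?_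
    · have h1 : 2 ^ k ≤ n := (mem_Ico.1 (mem_filter.1 hn).1).1
      rw [one_div_pow]
      exact one_div_le_one_div_of_le (by positivity) (by exact_mod_cast h1)
    · rw [nsmul_eq_mul]
      have := (h k).le
      gcongr
  have dyadic : ∀ n, ∑ i ∈ range (2 ^ n), g i ≤ T * (2 - 2 * (1 / 2 : ℝ) ^ n) := by
    intro n
    induction n with
    | zero => simp [hg, Set.indicator_apply]
    | succ n ih =>
      rw [range_eq_Ico, ← sum_Ico_consecutive _ (Nat.zero_le (2 ^ n))
        (Nat.pow_le_pow_right (by norm_num) (Nat.le_succ n)), ← range_eq_Ico]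
      have := block n
      rw [pow_succ (1 / 2 : ℝ)]
      linarith
  refine summable_of_sum_range_le (c := T * 2) g_nonneg fun n => ?_
  refine (sum_le_sum_of_subset_of_nonneg (range_mono n.lt_two_pow_self.le)
    fun i _ _ => g_nonneg i).trans ((dyadic n).trans ?_)
  gcongr
  have : (0 : ℝ) ≤ (1 / 2) ^ n := by positivity
  linarith

lemma exists_odd_primes_within_factor_two (t : ℕ) :
    ∃ S : Finset ℕ, S.card = t ∧ (∀ p ∈ S, p.Prime ∧ 2 < p) ∧ ∀ p ∈ S, ∀ q ∈ S, q < 2 * p := by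
  obtain ⟨k, hk⟩ := exists_dyadic_block_card_primes_ge (t + 3)
  have hk2 : 2 ≤ k := by
    by_contra! hlt
    have h1 := hk.trans (Finset.card_filter_le _ _)
    interval_cases k <;> simp at h1
  obtain ⟨S, hS, hc⟩ := Finset.exists_subset_card_eq ((Nat.le_add_right t 3).trans hk)
  have hmem : ∀ p ∈ S, (2 ^ k ≤ p ∧ p < 2 * 2 ^ k) ∧ p.Prime := fun p hp => by
    have := hS hp
    rwa [Finset.mem_filter, Finset.mem_Ico, pow_succ'] at this
  have h4 : 2 ^ 2 ≤ 2 ^ k := Nat.pow_le_pow_right (by norm_num) hk2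
  refine ⟨S, hc, fun p hp => ⟨(hmem p hp).2, ?_⟩, fun p hp q hq => ?_⟩
  · have := (hmem p hp).1.1
    omega
  · have := (hmem p hp).1.1
    have := (hmem q hq).1.2
    omega

lemma prod_cyclotomic_mul_prime_pow_eq_expand {p d : ℕ} (hp : p.Prime) (hd : ¬ p ∣ d) (a : ℕ) :
    (∏ b ∈ Finset.range a, cyclotomic (d * p ^ (b + 1)) ℤ) * cyclotomic d ℤ
      = expand ℤ (p ^ a) (cyclotomic d ℤ) := by
  induction a with
  | zero => simp
  | succ a ih =>
    rw [pow_succ', ← expand_expand, ← ih, map_mul, map_prod,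
      cyclotomic_expand_eq_cyclotomic_mul hp hd, Finset.prod_range_succ', ← mul_assoc]
    congr 2
    · refine Finset.prod_congr rfl fun b _ => ?_
      rw [cyclotomic_expand_eq_cyclotomic hp (Dvd.intro_left _ (by rw [pow_succ, mul_assoc])),
        mul_assoc, ← pow_succ]
    · simp

lemma unitaryCyclotomic_mul_prime_pow {p N a : ℕ} (hp : p.Prime) (hN : ¬ p ∣ N) (ha : a ≠ 0) :
    unitaryCyclotomic (N * p ^ a) * unitaryCyclotomic N
      = expand ℤ (p ^ a) (unitaryCyclotomic N) := by
  have hN0 : N ≠ 0 := fun h => hN (h ▸ dvd_zero p)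
  have hpdvd : ∀ d, d ∣ N → ¬ p ∣ d := fun d hd h => hN (h.trans hd)
  have key : unitaryCyclotomic (N * p ^ a)
      = ∏ d ∈ N.divisors.filter (fun d => d.primeFactors = N.primeFactors),
        ∏ b ∈ Finset.range a, cyclotomic (d * p ^ (b + 1)) ℤ := by
    rw [← Finset.prod_product', unitaryCyclotomic]
    symm
    have pf : ∀ d b, d ∣ N → b ≠ 0 → (d * p ^ b).primeFactors = insert p d.primeFactors := by
      intro d b hd hb
      rw [Nat.primeFactors_mul (ne_zero_of_dvd_ne_zero hN0 hd) (pow_ne_zero _ hp.ne_zero),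
        Nat.primeFactors_prime_pow hb hp, Finset.union_comm, Finset.insert_eq]
    have pnot : ∀ d, d ∣ N → p ∉ d.primeFactors := fun d hd h =>
      hpdvd d hd (Nat.dvd_of_mem_primeFactors h)
    refine Finset.prod_bij (fun x _ => x.1 * p ^ (x.2 + 1)) ?_ ?_ ?_ ?_
    · rintro ⟨d, b⟩ hx
      simp only [Finset.mem_product, Finset.mem_filter, Nat.mem_divisors, Finset.mem_range] at hx
      obtain ⟨⟨⟨hd, -⟩, hpf⟩, hb⟩ := hx
      simp only [Finset.mem_filter, Nat.mem_divisors]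
      refine ⟨⟨mul_dvd_mul hd (pow_dvd_pow p hb), mul_ne_zero hN0 (pow_ne_zero _ hp.ne_zero)⟩, ?_⟩
      rw [pf d _ hd (Nat.succ_ne_zero b), pf N a dvd_rfl ha, hpf]
    · rintro ⟨d, b⟩ hx ⟨e, c⟩ hy heq
      simp only [Finset.mem_product, Finset.mem_filter, Nat.mem_divisors] at hx hy heq
      have hbc : b + 1 = c + 1 := by
        have := congrArg (fun n => n.factorization p) heq
        simpa [Nat.factorization_mul (ne_zero_of_dvd_ne_zero hN0 hx.1.1.1)
            (pow_ne_zero (b + 1) hp.ne_zero),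
          Nat.factorization_mul (ne_zero_of_dvd_ne_zero hN0 hy.1.1.1)
            (pow_ne_zero (c + 1) hp.ne_zero), hp.factorization_self,
          Nat.factorization_eq_zero_of_not_dvd (hpdvd d hx.1.1.1),
          Nat.factorization_eq_zero_of_not_dvd (hpdvd e hy.1.1.1)] using this
      rw [hbc] at heq
      have hde := Nat.eq_of_mul_eq_mul_right (pow_pos hp.pos _) heq
      rw [Prod.mk.injEq]
      exact ⟨hde, by omega⟩
    · intro n hn
      simp only [Finset.mem_filter, Nat.mem_divisors] at hn
      obtain ⟨⟨hdvd, -⟩, hpf⟩ := hn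
      obtain ⟨d, e, hd, he, rfl⟩ := (Nat.dvd_mul).1 hdvd
      obtain ⟨b, hb, rfl⟩ := (Nat.dvd_prime_pow hp).1 he
      have hb0 : b ≠ 0 := by
        rintro rfl
        rw [pow_zero, mul_one, pf N a dvd_rfl ha] at hpf
        exact pnot d hd (hpf ▸ Finset.mem_insert_self _ _)
      rw [pf d b hd hb0, pf N a dvd_rfl ha] at hpf
      have hpf' : d.primeFactors = N.primeFactors := by
        rw [← Finset.erase_insert (pnot d hd), hpf, Finset.erase_insert (pnot N dvd_rfl)]
      refine ⟨(d, b - 1), ?_, ?_⟩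
      · simp only [Finset.mem_product, Finset.mem_filter, Nat.mem_divisors, Finset.mem_range]
        exact ⟨⟨⟨hd, hN0⟩, hpf'⟩, by omega⟩
      · simp only [Nat.sub_add_cancel (Nat.one_le_iff_ne_zero.2 hb0)]
    · intros
      rfl
  rw [key, unitaryCyclotomic, ← Finset.prod_mul_distrib, map_prod]
  refine Finset.prod_congr rfl fun d hd => ?_
  exact prod_cyclotomic_mul_prime_pow_eq_expand hp
    (hpdvd d (Nat.dvd_of_mem_divisors (Finset.mem_filter.1 hd).1)) a

lemma unitaryCyclotomic_coeff_zero {N : ℕ} (hN : 1 < N) : (unitaryCyclotomic N).coeff 0 = 1 := by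
  rw [unitaryCyclotomic, coeff_zero_prod]
  refine Finset.prod_eq_one fun d hd => cyclotomic_coeff_zero ℤ ?_
  simp only [Finset.mem_filter, Nat.mem_divisors] at hd
  obtain ⟨⟨hd, hN0⟩, hpf⟩ := hd
  have hd0 : d ≠ 0 := ne_zero_of_dvd_ne_zero hN0 hd
  have : d ≠ 1 := by
    rintro rfl
    have := Nat.nonempty_primeFactors.2 hN
    rw [← hpf] at this
    simp at this
  omega

lemma unitaryCyclotomic_mul_unitaryCyclotomicInv {N : ℕ} (hN : 0 < N) :
    unitaryCyclotomic N * unitaryCyclotomicInv N = X ^ N - 1 := by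
  have hmonic : (unitaryCyclotomic N).Monic :=
    monic_prod_of_monic _ _ fun d _ => cyclotomic.monic d ℤ
  have hdvd : unitaryCyclotomic N ∣ X ^ N - 1 := by
    rw [← prod_cyclotomic_eq_X_pow_sub_one hN ℤ]
    exact Finset.prod_dvd_prod_of_subset _ _ _ (Finset.filter_subset _ _)
  have h := modByMonic_add_div (X ^ N - 1 : ℤ[X]) (unitaryCyclotomic N)
  rwa [(modByMonic_eq_zero_iff_dvd hmonic).2 hdvd, zero_add] at h

/-- Congruence of integer polynomials modulo `X ^ (K + 1)`. -/
def EqUpTo (K : ℕ) (f g : ℤ[X]) : Prop := (X : ℤ[X]) ^ (K + 1) ∣ f - g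

lemma EqUpTo.coeff_eq {K j : ℕ} {f g : ℤ[X]} (h : EqUpTo K f g) (hj : j ≤ K) :
    f.coeff j = g.coeff j := by
  have := X_pow_dvd_iff.1 h j (by omega)
  rwa [coeff_sub, sub_eq_zero] at this

lemma EqUpTo.trans {K : ℕ} {f g h : ℤ[X]} (h₁ : EqUpTo K f g) (h₂ : EqUpTo K g h) :
    EqUpTo K f h := by
  simpa [EqUpTo] using dvd_add h₁ h₂

lemma eqUpTo_expand {K q : ℕ} (f : ℤ[X]) (hq : K < 2 * q) :
    EqUpTo K (expand ℤ q f) (C (f.coeff 0) + C (f.coeff 1) * X ^ q) := by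
  refine X_pow_dvd_iff.2 fun j hj => ?_
  have hq0 : 0 < q := by omega
  rw [coeff_sub, coeff_expand hq0, coeff_add, coeff_C, coeff_C_mul_X_pow, sub_eq_zero]
  by_cases h : q ∣ j
  · obtain ⟨c, rfl⟩ := h
    have hc : c < 2 := by
      by_contra! h2
      have := Nat.mul_le_mul_left q h2
      omega
    rw [Nat.mul_div_cancel_left c hq0]
    interval_cases c <;> simp [hq0.ne, hq0.ne']
  · have h0 : j ≠ 0 := fun h0 => h (h0 ▸ dvd_zero q)
    have hjq : j ≠ q := fun hjq => h (hjq ▸ dvd_rfl)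
    simp [h, h0, hjq]

lemma unitaryCyclotomic_mul_large_prime {K N Q : ℕ} (hN : 1 < N) (hQ : Q.Prime) (hQN : ¬ Q ∣ N)
    (hKQ : K < Q) : EqUpTo K (unitaryCyclotomic (N * Q) * unitaryCyclotomic N) 1 := by
  have h := unitaryCyclotomic_mul_prime_pow hQ hQN one_ne_zero
  rw [pow_one] at h
  rw [h]
  refine (eqUpTo_expand _ (by omega)).trans ?_
  rw [unitaryCyclotomic_coeff_zero hN, EqUpTo, C_1, add_sub_cancel_left]
  exact (pow_dvd_pow X hKQ).mul_left _

/-- Adjoining a prime power `p ^ a` and then a large prime `Q` multiplies the truncated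
polynomial by `1 - c X ^ (p ^ a)`, where `c` is the linear coefficient. -/
lemma unitaryCyclotomic_adjoin {K N p a Q : ℕ} (hN : 1 < N) (hp : p.Prime) (hpN : ¬ p ∣ N)
    (ha : a ≠ 0) (hK : K < 2 * p ^ a) (hQ : Q.Prime) (hQN : N * p ^ a < Q) (hKQ : K < Q) :
    EqUpTo K (unitaryCyclotomic (N * p ^ a * Q))
      (unitaryCyclotomic N * (1 - C ((unitaryCyclotomic N).coeff 1) * X ^ p ^ a)) := by
  have hpa : 0 < p ^ a := pow_pos hp.pos a
  have hM : 1 < N * p ^ a := hN.trans_le (Nat.le_mul_of_pos_right N hpa)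
  have h₁ := unitaryCyclotomic_mul_large_prime (K := K) hM hQ
    (fun h => absurd (Nat.le_of_dvd (by omega) h) (by omega)) hKQ
  have h₂ := eqUpTo_expand (unitaryCyclotomic N) hK
  rw [← unitaryCyclotomic_mul_prime_pow hp hpN ha, unitaryCyclotomic_coeff_zero hN, C_1] at h₂
  have h₃ : (X : ℤ[X]) ^ (K + 1) ∣ X ^ p ^ a * X ^ p ^ a := by
    rw [← pow_add]
    exact pow_dvd_pow X (by omega)
  obtain ⟨u, hu⟩ := h₁
  obtain ⟨v, hv⟩ := h₂
  obtain ⟨w, hw⟩ := h₃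
  set c := C ((unitaryCyclotomic N).coeff 1)
  set F := unitaryCyclotomic N
  set G := unitaryCyclotomic (N * p ^ a)
  set H := unitaryCyclotomic (N * p ^ a * Q)
  refine ⟨F * (1 - c * X ^ p ^ a) * u - H * (1 - c * X ^ p ^ a) * v + H * c ^ 2 * w, ?_⟩
  linear_combination F * (1 - c * X ^ p ^ a) * hu - H * (1 - c * X ^ p ^ a) * hv + H * c ^ 2 * hw

lemma exists_eqUpTo_of_primes_dvd (K : ℕ) (s : Finset ℕ) (hs : ∀ p ∈ s, p.Prime) {N : ℕ}
    (hN : 1 < N) : ∃ M, 1 < M ∧ (∀ p ∈ s, p ∣ M) ∧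
      EqUpTo K (unitaryCyclotomic M) (unitaryCyclotomic N) := by
  induction s using Finset.induction_on with
  | empty => exact ⟨N, hN, by simp, by simp [EqUpTo]⟩
  | insert p s _ ih =>
    obtain ⟨M, hM, hdvd, hMN⟩ := ih fun q hq => hs q (Finset.mem_insert_of_mem hq)
    have hp := hs p (Finset.mem_insert_self p s)
    by_cases hpM : p ∣ M
    · refine ⟨M, hM, fun q hq => ?_, hMN⟩
      rcases Finset.mem_insert.1 hq with rfl | hq
      exacts [hpM, hdvd q hq]
    have hpow : K + 1 < p ^ (K + 1) := Nat.lt_pow_self hp.one_lt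
    obtain ⟨Q, hQle, hQ⟩ := Nat.exists_infinite_primes (M * p ^ (K + 1) + K + 1)
    refine ⟨M * p ^ (K + 1) * Q, ?_, fun q hq => ?_, ?_⟩
    · exact hM.trans_le ((Nat.le_mul_of_pos_right M (by omega)).trans
        (Nat.le_mul_of_pos_right _ hQ.pos))
    · rcases Finset.mem_insert.1 hq with rfl | hq
      · exact ((dvd_pow_self q (Nat.add_one_ne_zero K)).mul_left M).mul_right Q
      · exact ((hdvd q hq).mul_right _).mul_right Q
    · refine (unitaryCyclotomic_adjoin hM hp hpM (Nat.add_one_ne_zero K) (by omega) hQ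
        (by omega) (by omega)).trans (EqUpTo.trans ?_ hMN)
      rw [EqUpTo, mul_sub, mul_one, sub_sub_cancel_left, dvd_neg, ← mul_assoc]
      exact (pow_dvd_pow X hpow.le).mul_left _

lemma exists_eqUpTo_one_sub_sum {K N : ℕ} (hN : 1 < N) (hK : 1 ≤ K)
    (hNp : ∀ p, p.Prime → p ∣ N → p = 2 ∨ K < p) (S : Finset ℕ)
    (hS : ∀ p ∈ S, p.Prime ∧ 2 < p ∧ p ≤ K ∧ K < 2 * p) :
    ∃ M, 1 < M ∧ (∀ p, p.Prime → p ∣ M → p ∈ S ∨ p = 2 ∨ K < p) ∧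
      (unitaryCyclotomic M).coeff 1 = (unitaryCyclotomic N).coeff 1 ∧
      EqUpTo K (unitaryCyclotomic M) (unitaryCyclotomic N *
        (1 - C ((unitaryCyclotomic N).coeff 1) * ∑ p ∈ S, X ^ p)) := by
  induction S using Finset.induction_on with
  | empty => exact ⟨N, hN, fun p hp h => Or.inr (hNp p hp h), rfl, by simp [EqUpTo]⟩
  | insert p S hpS ih =>
    obtain ⟨M, hM, hMp, hM1, hMN⟩ := ih fun q hq => hS q (Finset.mem_insert_of_mem hq)
    obtain ⟨hp, hp2, hpK, hKp⟩ := hS p (Finset.mem_insert_self p S)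
    have hpM : ¬ p ∣ M := fun h => by
      rcases hMp p hp h with h | h | h
      · exact hpS h
      · omega
      · omega
    obtain ⟨Q, hQle, hQ⟩ := Nat.exists_infinite_primes (M * p + K + 1)
    have hadj := unitaryCyclotomic_adjoin (K := K) (a := 1) hM hp hpM one_ne_zero (by simpa) hQ
      (by rw [pow_one]; omega) (by omega)
    simp only [pow_one, hM1] at hadj
    refine ⟨M * p * Q, ?_, fun q hq hdvd => ?_, ?_, hadj.trans ?_⟩
    · exact hM.trans_le ((Nat.le_mul_of_pos_right M hp.pos).trans
        (Nat.le_mul_of_pos_right _ hQ.pos))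
    · rcases (hq.dvd_mul).1 hdvd with hdvd | hdvd
      · rcases (hq.dvd_mul).1 hdvd with hdvd | hdvd
        · rcases hMp q hq hdvd with h | h
          exacts [Or.inl (Finset.mem_insert_of_mem h), Or.inr h]
        · rw [(Nat.prime_dvd_prime_iff_eq hq hp).1 hdvd]
          exact Or.inl (Finset.mem_insert_self p S)
      · rw [(Nat.prime_dvd_prime_iff_eq hq hQ).1 hdvd]
        exact Or.inr (Or.inr (by omega))
    · rw [hadj.coeff_eq hK, mul_sub, mul_one, coeff_sub, ← mul_assoc, coeff_mul_X_pow',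
        if_neg (by omega), sub_zero, hM1]
    · have hcross : (X : ℤ[X]) ^ (K + 1) ∣ (∑ q ∈ S, X ^ q) * X ^ p := by
        rw [Finset.sum_mul]
        refine Finset.dvd_sum fun q hq => ?_
        have := (hS q (Finset.mem_insert_of_mem hq)).2.2.2
        rw [← pow_add]
        exact pow_dvd_pow X (by omega)
      rw [Finset.sum_insert hpS]
      obtain ⟨u, hu⟩ := hMN
      obtain ⟨v, hv⟩ := hcross
      set c := C ((unitaryCyclotomic N).coeff 1)
      set F := unitaryCyclotomic N
      set G := unitaryCyclotomic M
      refine ⟨u * (1 - c * X ^ p) + F * c ^ 2 * v, ?_⟩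
      linear_combination (1 - c * X ^ p) * hu + F * c ^ 2 * hv

lemma unitaryCyclotomic_one : unitaryCyclotomic 1 = X - 1 := by
  simp [unitaryCyclotomic, Finset.filter_singleton]

lemma unitaryCyclotomic_prime {p : ℕ} (hp : p.Prime) :
    unitaryCyclotomic p = ∑ i ∈ Finset.range p, X ^ i := by
  have h := unitaryCyclotomic_mul_prime_pow (N := 1) hp hp.not_dvd_one one_ne_zero
  rw [pow_one, one_mul, unitaryCyclotomic_one, map_sub, expand_X, map_one, ← geom_sum_mul] at h
  exact mul_right_cancel₀ (X_sub_C_ne_zero (1 : ℤ)) (by simpa using h)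

lemma unitaryCyclotomic_prime_coeff {p j : ℕ} (hp : p.Prime) (hj : j < p) :
    (unitaryCyclotomic p).coeff j = 1 := by
  simp [unitaryCyclotomic_prime hp, coeff_X_pow, hj]

lemma unitaryCyclotomic_two_mul_prime_coeff {p j : ℕ} (hp : p.Prime) (hp2 : 2 < p) (hj : j < p) :
    (unitaryCyclotomic (2 * p)).coeff j = (-1) ^ j := by
  have hp' : ¬ p ∣ 2 := fun h => absurd (Nat.le_of_dvd two_pos h) (by omega)
  have h := unitaryCyclotomic_mul_prime_pow (N := 2) hp hp' one_ne_zero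
  have h2 : unitaryCyclotomic 2 = X + 1 := by
    simp [unitaryCyclotomic_prime Nat.prime_two, Finset.sum_range_succ, add_comm]
  rw [pow_one, h2, map_add, expand_X, map_one] at h
  induction j with
  | zero => simpa using unitaryCyclotomic_coeff_zero (N := 2 * p) (by omega)
  | succ j ih =>
    have hc := congrArg (fun f : ℤ[X] => f.coeff (j + 1)) h
    simp only [mul_add, mul_one, coeff_add, coeff_mul_X, coeff_X_pow, coeff_one] at hc
    rw [ih (by omega), if_neg (by omega), if_neg (by omega)] at hc
    rw [pow_succ]
    linarith

lemma exists_unitaryCyclotomic_coeff_eq {m : ℕ} (hsf : Squarefree m) (t : ℤ) :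
    ∃ K N : ℕ, 1 < N ∧ m ∣ N ∧ (unitaryCyclotomic N).coeff K = t := by
  obtain ⟨S, hcard, hprime, hfactor⟩ := exists_odd_primes_within_factor_two (t.natAbs + 1)
  have hne : S.Nonempty := Finset.card_pos.1 (by omega)
  set K := S.max' hne with hKdef
  have hKS : K ∈ S := S.max'_mem hne
  have hS : ∀ p ∈ S, p.Prime ∧ 2 < p ∧ p ≤ K ∧ K < 2 * p := fun p hp =>
    ⟨(hprime p hp).1, (hprime p hp).2, S.le_max' p hp, hfactor p hp K hKS⟩
  have hK2 : 2 < K := (hprime K hKS).2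
  obtain ⟨Q, hKQ, hQ⟩ := Nat.exists_infinite_primes (K + 1)
  suffices h : ∃ N, 1 < N ∧ (∀ p, p.Prime → p ∣ N → p = 2 ∨ K < p) ∧
      (unitaryCyclotomic N).coeff K - (unitaryCyclotomic N).coeff 1 *
        ∑ p ∈ S, (unitaryCyclotomic N).coeff (K - p) = t by
    obtain ⟨N, hN, hNp, hNt⟩ := h
    obtain ⟨M, hM, -, -, hMN⟩ := exists_eqUpTo_one_sub_sum hN (by omega) hNp S hS
    obtain ⟨L, hL, hLdvd, hLM⟩ := exists_eqUpTo_of_primes_dvd K m.primeFactors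
      (fun p hp => Nat.prime_of_mem_primeFactors hp) hM
    refine ⟨K, L, hL, ?_, ?_⟩
    · rw [← Nat.prod_primeFactors_of_squarefree hsf]
      exact Finset.prod_primes_dvd L
        (fun p hp => (Nat.prime_of_mem_primeFactors hp).prime) hLdvd
    · rw [(hLM.trans hMN).coeff_eq le_rfl, ← hNt, mul_sub, mul_one, coeff_sub, mul_left_comm,
        coeff_C_mul, Finset.mul_sum, finsetSum_coeff]
      congr 2
      exact Finset.sum_congr rfl fun p hp => by rw [coeff_mul_X_pow', if_pos (hS p hp).2.2.1]
  rcases le_total t 0 with ht | ht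
  · refine ⟨Q, hQ.one_lt, fun p hp h => ?_, ?_⟩
    · rw [(Nat.prime_dvd_prime_iff_eq hp hQ).1 h]
      exact Or.inr hKQ
    · rw [unitaryCyclotomic_prime_coeff hQ hKQ, unitaryCyclotomic_prime_coeff hQ (by omega),
        Finset.sum_congr rfl fun p _ => unitaryCyclotomic_prime_coeff hQ (j := K - p) (by omega)]
      simp only [Finset.sum_const, hcard, nsmul_eq_mul]
      push_cast
      rw [abs_of_nonpos ht]
      ring
  · have hQ2 : 2 < Q := by omega
    refine ⟨2 * Q, by omega, fun p hp h => ?_, ?_⟩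
    · rcases (hp.dvd_mul).1 h with h | h
      · exact Or.inl ((Nat.prime_dvd_prime_iff_eq hp Nat.prime_two).1 h)
      · rw [(Nat.prime_dvd_prime_iff_eq hp hQ).1 h]
        exact Or.inr hKQ
    · have hodd : ∀ p ∈ S, Odd p := fun p hp =>
        (hprime p hp).1.odd_of_ne_two (hprime p hp).2.ne'
      have hsum : ∀ p ∈ S, (unitaryCyclotomic (2 * Q)).coeff (K - p) = 1 := fun p hp => by
        rw [unitaryCyclotomic_two_mul_prime_coeff hQ hQ2 (by omega)]
        exact ((hodd K hKS).tsub_odd (hodd p hp)).neg_one_pow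
      rw [unitaryCyclotomic_two_mul_prime_coeff hQ hQ2 hKQ,
        unitaryCyclotomic_two_mul_prime_coeff hQ hQ2 (by omega), Finset.sum_congr rfl hsum,
        (hodd K hKS).neg_one_pow]
      simp only [Finset.sum_const, hcard, nsmul_eq_mul]
      push_cast
      rw [abs_of_nonneg ht]
      ring

lemma unitaryCyclotomicInv_mul_large_prime {K N Q : ℕ} (hN : 1 < N) (hQ : Q.Prime)
    (hQN : ¬ Q ∣ N) (hKQ : K < Q) :
    EqUpTo K (unitaryCyclotomicInv (N * Q)) (-unitaryCyclotomic N) := by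
  have hNQ : K + 1 ≤ N * Q := hKQ.trans_le (Nat.le_mul_of_pos_left Q (by omega))
  obtain ⟨u, hu⟩ := unitaryCyclotomic_mul_large_prime hN hQ hQN hKQ
  have hinv := unitaryCyclotomic_mul_unitaryCyclotomicInv (N := N * Q) (by omega)
  obtain ⟨v, hv⟩ : (X : ℤ[X]) ^ (K + 1) ∣ X ^ (N * Q) := pow_dvd_pow X hNQ
  set F := unitaryCyclotomic N
  set I := unitaryCyclotomicInv (N * Q)
  refine ⟨F * v - I * u, ?_⟩
  linear_combination F * hinv - I * hu + F * hv

/-- For fixed squarefree `m ≥ 1`, every integer occurs as a coefficient of `Φ*_{mn}`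
for some `n ≥ 1`, and every integer occurs as a coefficient of `Ψ*_{mn}` for some `n ≥ 1`. -/
theorem every_int_is_coeff_of_squarefree (m : ℕ) (hm : 1 ≤ m) (hsf : Squarefree m) (t : ℤ) :
    (∃ n : ℕ, 1 ≤ n ∧ ∃ j : ℕ, (unitaryCyclotomic (m * n)).coeff j = t) ∧
    (∃ n : ℕ, 1 ≤ n ∧ ∃ j : ℕ, (unitaryCyclotomicInv (m * n)).coeff j = t) := by
  constructor
  · obtain ⟨K, N, hN, ⟨n, rfl⟩, hK⟩ := exists_unitaryCyclotomic_coeff_eq hsf t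
    exact ⟨n, Nat.pos_of_ne_zero (by rintro rfl; omega), K, hK⟩
  · obtain ⟨K, N, hN, ⟨n, rfl⟩, hK⟩ := exists_unitaryCyclotomic_coeff_eq hsf (-t)
    obtain ⟨Q, hQle, hQ⟩ := Nat.exists_infinite_primes (m * n + K + 1)
    have hn : 0 < n := Nat.pos_of_ne_zero (by rintro rfl; omega)
    refine ⟨n * Q, Nat.mul_pos hn hQ.pos, K, ?_⟩
    have h := unitaryCyclotomicInv_mul_large_prime (K := K) hN hQ
      (fun h => absurd (Nat.le_of_dvd (by omega) h) (by omega)) (by omega)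
    rw [← mul_assoc, h.coeff_eq le_rfl, coeff_neg, hK, neg_neg]
end

section
/- Let a < b be coprime prime powers, each > 1. Then Ψ*_{ab}(X) = −1 − X − ⋯ − X^{a−1} + X^{b} + X^{b+1} + ⋯ + X^{a+b−1}; that is, the coefficient of X^j in Ψ*_{ab} is −1 for 0 ≤ j ≤ a−1, is 1 for b ≤ j ≤ a+b−1, and is 0 otherwise. In particular, Ψ*_{ab}(X)·(X − 1) = (X^a − 1)(X^b − 1). -/
open Polynomial

/-- If `a` and `b` are coprime prime powers, a divisor of `a * b` has the same prime factors as
`a * b` unless it divides `a` or `b`. -/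
lemma primeFactors_ne_iff_dvd_or_dvd {a b d : ℕ} (ha : IsPrimePow a) (hb : IsPrimePow b)
    (hab : Nat.Coprime a b) (hd : d ∣ a * b) :
    d.primeFactors ≠ (a * b).primeFactors ↔ d ∣ a ∨ d ∣ b := by
  obtain ⟨p, k, hp, hk, rfl⟩ := (isPrimePow_nat_iff a).1 ha
  obtain ⟨q, l, hq, hl, rfl⟩ := (isPrimePow_nat_iff b).1 hb
  have hpq : Nat.Coprime p q :=
    (Nat.coprime_pow_left_iff hk _ _).1 ((Nat.coprime_pow_right_iff hl _ _).1 hab)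
  have hne : p ^ k * q ^ l ≠ 0 := by simp [hp.ne_zero, hq.ne_zero]
  have hd0 : d ≠ 0 := ne_zero_of_dvd_ne_zero hne hd
  constructor
  · intro h
    by_contra! hcon
    refine h (Finset.Subset.antisymm (Nat.primeFactors_mono hd hne) ?_)
    rw [hab.primeFactors_mul, Nat.primeFactors_prime_pow hk.ne' hp,
      Nat.primeFactors_prime_pow hl.ne' hq]
    have hpd : p ∣ d := by
      by_contra h'
      exact hcon.2 ((((hp.coprime_iff_not_dvd.2 h').symm).pow_right k).dvd_of_dvd_mul_left hd)
    have hqd : q ∣ d := by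
      by_contra h'
      exact hcon.1 ((((hq.coprime_iff_not_dvd.2 h').symm).pow_right l).dvd_of_dvd_mul_right hd)
    intro r hr
    simp only [Finset.mem_union, Finset.mem_singleton] at hr
    rcases hr with rfl | rfl
    · exact Nat.mem_primeFactors.2 ⟨hp, hpd, hd0⟩
    · exact Nat.mem_primeFactors.2 ⟨hq, hqd, hd0⟩
  · rintro h heq
    have hpd : p ∣ d := Nat.dvd_of_mem_primeFactors (heq ▸ Nat.mem_primeFactors.2
      ⟨hp, (dvd_pow_self p hk.ne').mul_right _, hne⟩)
    have hqd : q ∣ d := Nat.dvd_of_mem_primeFactors (heq ▸ Nat.mem_primeFactors.2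
      ⟨hq, (dvd_pow_self q hl.ne').mul_left _, hne⟩)
    rcases h with h | h
    · exact hq.ne_one (Nat.eq_one_of_dvd_coprimes (hpq.pow_left k) (hqd.trans h) dvd_rfl)
    · exact hp.ne_one (Nat.eq_one_of_dvd_coprimes (hpq.pow_right l) dvd_rfl (hpd.trans h))

/-- For coprime prime powers `a` and `b`, the cofactor of `Φ*_{ab}` in `X^{ab} − 1` is
`(1 + X + ⋯ + X^{a−1})(X^b − 1)`. -/
lemma unitaryCyclotomic_mul_geom_sum_mul {a b : ℕ} (ha : IsPrimePow a) (hb : IsPrimePow b)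
    (hab : Nat.Coprime a b) :
    unitaryCyclotomic (a * b) * ((∑ i ∈ Finset.range a, X ^ i) * (X ^ b - 1)) =
      X ^ (a * b) - 1 := by
  have hne : a * b ≠ 0 := mul_ne_zero ha.ne_zero hb.ne_zero
  have hdisj : Disjoint (a.divisors.erase 1) b.divisors := by
    rw [Finset.disjoint_left]
    intro d hda hdb
    rw [Finset.mem_erase, Nat.mem_divisors] at hda
    exact hda.1 (Nat.eq_one_of_dvd_coprimes hab hda.2.1 (Nat.dvd_of_mem_divisors hdb))
  have hcompl : (a * b).divisors.filter (fun d => ¬ d.primeFactors = (a * b).primeFactors) =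
      a.divisors.erase 1 ∪ b.divisors := by
    ext d
    simp only [Finset.mem_filter, Finset.mem_union, Finset.mem_erase, Nat.mem_divisors]
    constructor
    · rintro ⟨⟨hd, -⟩, h⟩
      have h1 : d = 1 → d ∣ b := fun h => h ▸ one_dvd b
      have := (primeFactors_ne_iff_dvd_or_dvd ha hb hab hd).1 h
      have := ha.ne_zero
      have := hb.ne_zero
      tauto
    · intro h
      have h' : d ∣ a ∨ d ∣ b := by tauto
      have hd : d ∣ a * b := h'.elim (·.mul_right _) (·.mul_left _)
      exact ⟨⟨hd, hne⟩, (primeFactors_ne_iff_dvd_or_dvd ha hb hab hd).2 h'⟩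
  rw [← prod_cyclotomic_eq_geom_sum ha.pos, ← prod_cyclotomic_eq_X_pow_sub_one hb.pos,
    ← prod_cyclotomic_eq_X_pow_sub_one (Nat.pos_of_ne_zero hne), ← Finset.prod_union hdisj,
    ← hcompl, unitaryCyclotomic, Finset.prod_filter_mul_prod_filter_not]

lemma unitaryCyclotomic_monic (n : ℕ) : (unitaryCyclotomic n).Monic :=
  monic_prod_of_monic _ _ fun d _ => cyclotomic.monic d ℤ

lemma unitaryCyclotomicInv_mul_eq_geom_sum_mul {a b : ℕ} (ha : IsPrimePow a) (hb : IsPrimePow b)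
    (hab : Nat.Coprime a b) :
    unitaryCyclotomicInv (a * b) = (∑ i ∈ Finset.range a, X ^ i) * (X ^ b - 1) := by
  rw [unitaryCyclotomicInv, ← unitaryCyclotomic_mul_geom_sum_mul ha hb hab,
    mul_divByMonic_cancel_left _ (unitaryCyclotomic_monic _)]

/-- For coprime prime powers `1 < a < b`:
`Ψ*_{ab}(X) = −1 − X − ⋯ − X^{a−1} + X^b + ⋯ + X^{a+b−1}`; in particular
`Ψ*_{ab}(X)·(X − 1) = (X^a − 1)(X^b − 1)`. -/
theorem unitaryCyclotomicInv_two_prime_powers (a b : ℕ)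
    (ha : IsPrimePow a) (hb : IsPrimePow b) (hab : Nat.Coprime a b) (hlt : a < b) :
    (∀ j : ℕ, (unitaryCyclotomicInv (a * b)).coeff j =
      if j < a then -1 else if b ≤ j ∧ j < a + b then 1 else 0) ∧
    unitaryCyclotomicInv (a * b) * (X - 1) = (X ^ a - 1) * (X ^ b - 1) := by
  rw [unitaryCyclotomicInv_mul_eq_geom_sum_mul ha hb hab]
  constructor
  · intro j
    have hgeom (m : ℕ) : (∑ i ∈ Finset.range a, (X : ℤ[X]) ^ i).coeff m =
        if m < a then 1 else 0 := by
      simp [coeff_X_pow]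
    rw [mul_sub, mul_one, coeff_sub, coeff_mul_X_pow', hgeom, hgeom]
    split_ifs <;> omega
  · rw [mul_right_comm, geom_sum_mul]
end
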